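/- arXiv:2507.11762 — 2 statements merged into one kernel-verified Lean document; each statement's English description precedes it below -/
import Mathlib

section
/- Let n ≥ 1 and 1 ≤ k ≤ n, and let U_1,…,U_n be i.i.d. random variables uniformly distributed on [0,1]. Then the k-th order statistic U_{[k]} (the k-th smallest value) has the Beta(k, n−k+1) distribution, i.e., its law is the measure on ℝ with density x ↦ (n!/((k−1)!·(n−k)!))·x^{k−1}·(1−x)^{n−k} on (0,1) (and zero elsewhere) with respect to Lebesgue measure. -/
open MeasureTheory ProbabilityTheory Finset

/-- The `k`-th smallest value among `f 0, …, f (n-1)` (for `1 ≤ k ≤ n`). -/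
noncomputable def orderStat (n : ℕ) (f : Fin n → ℝ) (k : ℕ) : ℝ :=
  sInf {x : ℝ | k ≤ (Finset.univ.filter fun i => f i ≤ x).card}

/-- The `k`-th order statistic is at most `x` iff at least `k` of the values are. -/
theorem orderStat_le_iff {n k : ℕ} (hk1 : 1 ≤ k) (hkn : k ≤ n) (f : Fin n → ℝ) (x : ℝ) :
    orderStat n f k ≤ x ↔ k ≤ (univ.filter fun i => f i ≤ x).card := by
  have key : ∀ y : ℝ, k ≤ (univ.filter fun i => f i ≤ y).card ↔
      (f ∘ Tuple.sort f) ⟨k - 1, by omega⟩ ≤ y := by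
    intro y
    have h : (univ.filter fun i => f i ≤ y).card =
        (univ.filter fun i => (f ∘ Tuple.sort f) i ≤ y).card :=
      (Finset.card_equiv (Tuple.sort f) (by simp)).symm
    rw [h, ← Tuple.lt_card_le_iff_apply_le_of_monotone (Tuple.monotone_sort f)]
    dsimp only
    omega
  have hs : orderStat n f k = (f ∘ Tuple.sort f) ⟨k - 1, by omega⟩ := by
    simp only [orderStat, key]
    exact csInf_Ici
  rw [hs, key]

theorem measurable_orderStat {Ω : Type*} [MeasurableSpace Ω] {n k : ℕ} (hk1 : 1 ≤ k)
    (hkn : k ≤ n) {U : Fin n → Ω → ℝ} (hU : ∀ i, Measurable (U i)) :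
    Measurable fun ω => orderStat n (fun i => U i ω) k := by
  refine measurable_of_Iic fun x => ?_
  have hcard : Measurable fun ω => (univ.filter fun i => U i ω ≤ x).card := by
    simp only [card_filter]
    exact Finset.measurable_sum _ fun i _ =>
      Measurable.ite (measurableSet_le (hU i) measurable_const) measurable_const measurable_const
  have : (fun ω => orderStat n (fun i => U i ω) k) ⁻¹' Set.Iic x =
      (fun ω => (univ.filter fun i => U i ω ≤ x).card) ⁻¹' Set.Ici k := by
    ext ω
    exact orderStat_le_iff hk1 hkn _ x
  rw [this]
  exact hcard measurableSet_Ici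

/-- Upper tail of the binomial distribution: if independent variables fall in a set `A` with
probability `p` each, this is the probability that at least `k` of them do. -/
theorem measureReal_le_card_mem {Ω E : Type*} [MeasurableSpace Ω] [MeasurableSpace E]
    {μ : Measure Ω} [IsProbabilityMeasure μ] {n : ℕ} (k : ℕ) {U : Fin n → Ω → E}
    (hU : ∀ i, Measurable (U i)) (hind : iIndepFun U μ) {A : Set E} [DecidablePred (· ∈ A)]
    (hA : MeasurableSet A) {p : ℝ} (hp : ∀ i, μ.real (U i ⁻¹' A) = p) :
    μ.real {ω | k ≤ (univ.filter fun i => U i ω ∈ A).card} =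
      ∑ j ∈ Ico k (n + 1), (bernsteinPolynomial ℝ n j).eval p := by
  let B : Finset (Fin n) → Fin n → Set E := fun S i => if i ∈ S then A else Aᶜ
  have hB : ∀ S i, MeasurableSet (B S i) := by
    intro S i
    by_cases h : i ∈ S <;> simp [B, h, hA]
  have hmem : ∀ S ω, ω ∈ ⋂ i ∈ univ, U i ⁻¹' B S i ↔
      S = univ.filter fun i => U i ω ∈ A := by
    intro S ω
    simp only [mem_univ, Set.iInter_true, Set.mem_iInter, Set.mem_preimage, Finset.ext_iff,
      mem_filter, true_and]
    refine forall_congr' fun i => ?_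
    by_cases h : i ∈ S <;> simp [B, h]
  have hset : {ω | k ≤ (univ.filter fun i => U i ω ∈ A).card} =
      ⋃ S ∈ univ.filter (fun S : Finset (Fin n) => k ≤ S.card), ⋂ i ∈ univ, U i ⁻¹' B S i := by
    ext ω
    rw [Set.mem_iUnion₂]
    simp_rw [hmem]
    simp
  have hprob : ∀ S : Finset (Fin n), μ.real (⋂ i ∈ univ, U i ⁻¹' B S i) =
      p ^ S.card * (1 - p) ^ (n - S.card) := by
    intro S
    rw [measureReal_def, hind.measure_inter_preimage_eq_mul univ fun i _ => hB S i,
      ENNReal.toReal_prod]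
    have : ∀ i, μ.real (U i ⁻¹' B S i) = if i ∈ S then p else 1 - p := by
      intro i
      by_cases h : i ∈ S
      · simpa [B, h] using hp i
      · simpa [B, h, hp i] using probReal_compl_eq_one_sub (μ := μ) (hU i hA)
    simp only [← measureReal_def, this, prod_ite, prod_const]
    congr 2
    · simp
    · rw [filter_not, card_sdiff_of_subset (filter_subset _ _)]
      simp
  rw [hset, measureReal_biUnion_finset]
  · simp only [hprob, sum_filter]
    have h := sum_powerset_apply_card
      (fun j => if k ≤ j then p ^ j * (1 - p) ^ (n - j) else 0) (x := (univ : Finset (Fin n)))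
    rw [powerset_univ] at h
    rw [h, card_univ, Fintype.card_fin, ← sum_filter_add_sum_filter_not _ (fun j => k ≤ j)]
    rw [sum_eq_zero (s := filter (fun j => ¬ k ≤ j) _), add_zero]
    · refine sum_congr (by ext; simp; omega) fun j hj => ?_
      simp only [mem_Ico] at hj
      simp [bernsteinPolynomial, hj.1, mul_assoc]
    · intro j hj
      simp [(mem_filter.1 hj).2]
  · intro S _ T _ hST
    refine Set.disjoint_left.2 fun ω h1 h2 => hST ?_
    rw [(hmem S ω).1 h1, (hmem T ω).1 h2]
  · exact fun S _ => Finset.measurableSet_biInter _ fun i _ => hU i (hB S i)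

/-- The sum of the last Bernstein polynomials telescopes under differentiation. -/
theorem derivative_sum_bernsteinPolynomial (R : Type*) [CommRing R] {n k : ℕ} (hkn : k ≤ n) :
    Polynomial.derivative (∑ j ∈ Ico (k + 1) (n + 1), bernsteinPolynomial R n j) =
      n * bernsteinPolynomial R (n - 1) k := by
  rw [Polynomial.derivative_sum, ← sum_Ico_add' _ k n 1]
  simp only [bernsteinPolynomial.derivative_succ, ← mul_sum]
  rcases Nat.eq_zero_or_pos n with rfl | hn
  · simp
  simp only [← neg_sub (bernsteinPolynomial R (n - 1) (_ + 1)), sum_neg_distrib]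
  rw [sum_Ico_sub _ hkn, bernsteinPolynomial.eq_zero_of_lt R (by omega : n - 1 < n)]
  simp

theorem integral_beta_density {n k : ℕ} (hk1 : 1 ≤ k) (hkn : k ≤ n) (p : ℝ) :
    ∫ x in (0 : ℝ)..p, (n.factorial : ℝ) / ((k - 1).factorial * (n - k).factorial)
        * x ^ (k - 1) * (1 - x) ^ (n - k) =
      ∑ j ∈ Ico k (n + 1), (bernsteinPolynomial ℝ n j).eval p := by
  obtain ⟨m, rfl⟩ : ∃ m, k = m + 1 := ⟨k - 1, by omega⟩
  have hcoef : (n.factorial : ℝ) / (m.factorial * (n - (m + 1)).factorial) =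
      n * (n - 1).choose m := by
    rw [Nat.cast_choose ℝ (by omega : m ≤ n - 1), ← Nat.mul_factorial_pred (by omega : n ≠ 0),
      Nat.sub_add_eq, Nat.sub_right_comm]
    push_cast
    ring
  rw [intervalIntegral.integral_eq_sub_of_hasDerivAt
    (f := fun x => (∑ j ∈ Ico (m + 1) (n + 1), bernsteinPolynomial ℝ n j).eval x)]
  · rw [Polynomial.eval_finsetSum, Polynomial.eval_finsetSum, sub_eq_self]
    refine sum_eq_zero fun j hj => ?_
    rw [bernsteinPolynomial.eval_at_0, if_neg]
    have := (mem_Ico.1 hj).1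
    omega
  · intro x _
    refine (Polynomial.hasDerivAt _ x).congr_deriv ?_
    rw [derivative_sum_bernsteinPolynomial ℝ (by omega)]
    simp only [Nat.add_sub_cancel, hcoef, bernsteinPolynomial, Polynomial.eval_mul,
      Polynomial.eval_natCast, Polynomial.eval_pow, Polynomial.eval_X, Polynomial.eval_sub,
      Polynomial.eval_one]
    rw [show n - 1 - m = n - (m + 1) by omega]
    ring
  · exact Continuous.intervalIntegrable (by fun_prop) _ _

/-- The `k`-th order statistic of `n` i.i.d. Uniform(0,1) random variables has the
Beta(`k`, `n-k+1`) distribution, with Lebesgue density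
`x ↦ (n!/((k-1)!(n-k)!)) x^(k-1) (1-x)^(n-k)` on `(0,1)`. -/
theorem orderStat_uniform_beta
    {Ω : Type*} [MeasurableSpace Ω] (μ : Measure Ω) [IsProbabilityMeasure μ]
    (n k : ℕ) (hk1 : 1 ≤ k) (hkn : k ≤ n)
    (U : Fin n → Ω → ℝ) (hUmeas : ∀ i, Measurable (U i))
    (hUunif : ∀ i, Measure.map (U i) μ = volume.restrict (Set.Icc (0 : ℝ) 1))
    (hUindep : iIndepFun U μ) :
    Measure.map (fun ω => orderStat n (fun i => U i ω) k) μ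
      = volume.withDensity (fun x => ENNReal.ofReal
          (Set.indicator (Set.Ioo (0 : ℝ) 1)
            (fun x => (n.factorial : ℝ) / ((k - 1).factorial * (n - k).factorial)
              * x ^ (k - 1) * (1 - x) ^ (n - k)) x)) := by
  have hmeas := measurable_orderStat hk1 hkn hUmeas
  have : IsProbabilityMeasure (μ.map fun ω => orderStat n (fun i => U i ω) k) :=
    Measure.isProbabilityMeasure_map hmeas.aemeasurable
  refine Measure.ext_of_Iic _ _ fun x => ?_
  set p : ℝ := max 0 (min x 1) with hp
  have hp0 : 0 ≤ p := le_max_left _ _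
  have hp1 : p ≤ 1 := max_le zero_le_one (min_le_right _ _)
  have hUp : ∀ i, μ.real (U i ⁻¹' Set.Iic x) = p := by
    intro i
    rw [measureReal_def, ← Measure.map_apply (hUmeas i) measurableSet_Iic, hUunif i,
      Measure.restrict_apply measurableSet_Iic]
    have : Set.Iic x ∩ Set.Icc 0 1 = Set.Icc 0 (min x 1) := by
      ext t
      simp only [Set.mem_inter_iff, Set.mem_Iic, Set.mem_Icc, le_min_iff]
      tauto
    rw [this, Real.volume_Icc, sub_zero, ENNReal.toReal_ofReal', max_comm]
  have hL : (fun ω => orderStat n (fun i => U i ω) k) ⁻¹' Set.Iic x =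
      {ω | k ≤ (univ.filter fun i => U i ω ∈ Set.Iic x).card} := by
    ext ω
    simpa using orderStat_le_iff hk1 hkn (fun i => U i ω) x
  have hset : Set.Ioc 0 1 ∩ Set.Iic x = Set.Ioc 0 p := by
    ext t
    simp only [Set.mem_inter_iff, Set.mem_Iic, Set.mem_Ioc, hp, le_max_iff, le_min_iff]
    grind
  rw [Measure.map_apply hmeas measurableSet_Iic, hL, ← ofReal_measureReal,
    measureReal_le_card_mem k hUmeas hUindep measurableSet_Iic hUp,
    ← integral_beta_density hk1 hkn p, intervalIntegral.integral_of_le hp0,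
    ofReal_integral_eq_lintegral_ofReal, withDensity_apply _ measurableSet_Iic]
  · rw [← hset, ← Measure.restrict_restrict measurableSet_Ioc,
      setLIntegral_congr Ioo_ae_eq_Ioc.symm, ← lintegral_indicator measurableSet_Ioo]
    refine lintegral_congr fun t => ?_
    by_cases ht : t ∈ Set.Ioo (0 : ℝ) 1 <;> simp only [Set.indicator, ht, if_true, if_false,
      ENNReal.ofReal_zero]
  · exact (Continuous.integrableOn_Icc (by fun_prop)).mono_set Set.Ioc_subset_Icc_self
  · refine ae_restrict_of_forall_mem measurableSet_Ioc fun t ht => ?_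
    have h0 := ht.1.le
    have h1 : 0 ≤ 1 - t := by linarith [ht.2]
    simp only [Pi.zero_apply]
    positivity
end

section
/- (Theorem 1, Gaussian-mechanism instantiation.) Fix θ₀ ∈ (0,1), ε > 0, α ∈ (0,1), and a boundary constant δ ∈ (0, 1/2). For each n ≥ 1, let X_1,…,X_n be i.i.d. random variables in {0,1} with ℙ(X_i = 1) = θ₀, let Z be a standard Gaussian independent of the data, and set π̂_n = (1/n)∑_{i=1}^n X_i + Z/(nε). For p ∈ ℝ, let μ_p^{(n)} be the law of the FIMA solution S^{(n)}(p) built from independent auxiliary randomness Z* (standard Gaussian), U_1*,…,U_n* (i.i.d. Uniform(0,1)) and D (Beta(1/2,1/2)) as follows: set t = p − Z*/(nε); if t ≤ 0 put S = δ; if t ≥ 1 put S = 1 − δ; otherwise, with k = ⌊nt⌋ and order statistics U*_{[1]} ≤ … ≤ U*_{[n]} augmented by U*_{[0]} := δ and U*_{[n+1]} := 1 − δ, put S = U*_{[k]} + D·(U*_{[k+1]} − U*_{[k]}). Define the α-quantile q_α^{(n)}(p) = inf{ v ∈ ℝ : μ_p^{(n)}((−∞, v]) ≥ α }. Then the one-sided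 coverage of the FIMA quantile converges to the nominal level: ℙ(θ₀ ≤ q_α^{(n)}(π̂_n)) → α as n → ∞. -/
open MeasureTheory ProbabilityTheory Finset Filter Topology

/-- The `k`-th smallest value among `f 0, …, f (n-1)` (for `1 ≤ k ≤ n`). -/
noncomputable def kthSmallest (n : ℕ) (f : ℕ → ℝ) (k : ℕ) : ℝ :=
  sInf {x : ℝ | k ≤ ((Finset.range n).filter fun i => f i ≤ x).card}

/-- Order statistics of `f 0, …, f (n-1)` augmented by the boundary conventions
`U_{[0]} := δ` and `U_{[n+1]} := 1 - δ`. -/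
noncomputable def augOrderStat (n : ℕ) (δ : ℝ) (f : ℕ → ℝ) (k : ℕ) : ℝ :=
  if k = 0 then δ else if n + 1 ≤ k then 1 - δ else kthSmallest n f k

/-- The FIMA solution map: from a released value `p`, fresh noise `z⋆`, a fresh
uniform sample `u` and an interpolation variable `d`, set `t = p - z⋆/(nε)`; clip to
`δ` (resp. `1 - δ`) if `t ≤ 0` (resp. `t ≥ 1`); otherwise interpolate between the
`⌊nt⌋`-th and `(⌊nt⌋+1)`-th augmented order statistics of `u`. -/
noncomputable def fimaSol (n : ℕ) (ε δ p z d : ℝ) (u : ℕ → ℝ) : ℝ :=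
  let t := p - z / (n * ε)
  if t ≤ 0 then δ
  else if 1 ≤ t then 1 - δ
  else
    augOrderStat n δ u ⌊(n : ℝ) * t⌋₊
      + d * (augOrderStat n δ u (⌊(n : ℝ) * t⌋₊ + 1) - augOrderStat n δ u ⌊(n : ℝ) * t⌋₊)

/-- Density of the Beta(`a`,`b`) distribution on `(0,1)`. -/
noncomputable def betaDensity (a b : ℝ) : ℝ → ENNReal := fun x =>
  ENNReal.ofReal (Set.indicator (Set.Ioo (0 : ℝ) 1)
    (fun x => x ^ (a - 1) * (1 - x) ^ (b - 1)
      / (Real.Gamma a * Real.Gamma b / Real.Gamma (a + b))) x)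

lemma kthSmallest_le_iff {n k : ℕ} (f : ℕ → ℝ) (hk : 1 ≤ k) (hkn : k ≤ n) (x : ℝ) :
    kthSmallest n f k ≤ x ↔ k ≤ ((Finset.range n).filter fun i => f i ≤ x).card := by
  set A : Set ℝ := {x : ℝ | k ≤ ((Finset.range n).filter fun i => f i ≤ x).card} with hA
  have hmono : ∀ {x y : ℝ}, x ≤ y → x ∈ A → y ∈ A := fun {x y} hxy hx =>
    le_trans (α := ℕ) hx (Finset.card_le_card fun i hi => by
      simp only [Finset.mem_filter] at hi ⊢
      exact ⟨hi.1, hi.2.trans hxy⟩)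
  have hclosed : IsClosed A := by
    have : A = ⋃ s ∈ Finset.powersetCard k (Finset.range n), ⋂ i ∈ s, Set.Ici (f i) := by
      ext y
      simp only [hA, Set.mem_ofPred_eq, Set.mem_iUnion, Set.mem_iInter, Set.mem_Ici,
        Finset.mem_powersetCard, exists_prop]
      constructor
      · intro h
        obtain ⟨s, hs, hcard⟩ := Finset.exists_subset_card_eq h
        exact ⟨s, ⟨hs.trans (Finset.filter_subset _ _), hcard⟩,
          fun i hi => (Finset.mem_filter.1 (hs hi)).2⟩
      · rintro ⟨s, ⟨hs, rfl⟩, h⟩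
        exact Finset.card_le_card fun i hi => Finset.mem_filter.2 ⟨hs hi, h i hi⟩
    rw [this]
    exact isClosed_biUnion_finset fun s _ => isClosed_biInter fun i _ => isClosed_Ici
  have hbdd : BddBelow A := by
    obtain ⟨m, hm⟩ := ((Finset.range n).image f).bddBelow
    refine ⟨m, fun y hy => ?_⟩
    have hpos : 0 < ((Finset.range n).filter fun i => f i ≤ y).card := lt_of_lt_of_le hk hy
    obtain ⟨i, hi⟩ := Finset.card_pos.1 hpos
    rw [Finset.mem_filter] at hi
    exact (hm (Finset.mem_coe.2 (Finset.mem_image_of_mem f hi.1))).trans hi.2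
  have hne : A.Nonempty := by
    obtain ⟨m, hm⟩ := ((Finset.range n).image f).bddAbove
    refine ⟨m, ?_⟩
    rw [hA, Set.mem_ofPred_eq, Finset.filter_true_of_mem, Finset.card_range]
    · exact hkn
    · exact fun i hi => hm (Finset.mem_coe.2 (Finset.mem_image_of_mem f hi))
  exact ⟨fun h => hmono h (hclosed.csInf_mem hne hbdd), fun h => csInf_le hbdd h⟩

lemma kthSmallest_lt_of_le_card {n k : ℕ} (f : ℕ → ℝ) (hk : 1 ≤ k) {x : ℝ}
    (h : k ≤ ((Finset.range n).filter fun i => f i < x).card) : kthSmallest n f k < x := by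
  set s := (Finset.range n).filter fun i => f i < x with hs
  have hkn : k ≤ n := h.trans ((Finset.card_filter_le _ _).trans (Finset.card_range n).le)
  obtain ⟨j, hj, hmax⟩ := s.exists_max_image f (Finset.card_pos.1 (lt_of_lt_of_le hk h))
  refine lt_of_le_of_lt ?_ (Finset.mem_filter.1 hj).2
  refine (kthSmallest_le_iff f hk hkn _).2 (h.trans (Finset.card_le_card fun i hi => ?_))
  exact Finset.mem_filter.2 ⟨(Finset.mem_filter.1 hi).1, hmax i hi⟩

lemma kthSmallest_le_succ {n k : ℕ} (f : ℕ → ℝ) (hk : 1 ≤ k) (hkn : k + 1 ≤ n) :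
    kthSmallest n f k ≤ kthSmallest n f (k + 1) :=
  (kthSmallest_le_iff f hk (by omega) _).2 <| (Nat.le_succ k).trans <|
    (kthSmallest_le_iff f (by omega) hkn _).1 le_rfl

lemma measurable_augOrderStat (n : ℕ) (δ : ℝ) (k : ℕ) :
    Measurable fun f : ℕ → ℝ => augOrderStat n δ f k := by
  unfold augOrderStat
  split_ifs with h₁ h₂
  · exact measurable_const
  · exact measurable_const
  · refine measurable_of_Iic fun x => ?_
    have : (fun f : ℕ → ℝ => kthSmallest n f k) ⁻¹' Set.Iic x =
        {f | (k : ℝ) ≤ ∑ i ∈ Finset.range n, if f i ≤ x then (1 : ℝ) else 0} := by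
      ext f
      rw [Set.mem_preimage, Set.mem_Iic, kthSmallest_le_iff f (by omega) (by omega),
        Set.mem_ofPred_eq, Finset.sum_boole, Nat.cast_le]
    rw [this]
    refine measurableSet_le measurable_const (Finset.measurable_fun_sum _ fun i _ => ?_)
    exact Measurable.ite (measurableSet_le (measurable_pi_apply i) measurable_const)
      measurable_const measurable_const

lemma Measurable.fimaSol {Ω : Type*} [MeasurableSpace Ω] {z d : Ω → ℝ} {u : ℕ → Ω → ℝ}
    (hz : Measurable z) (hd : Measurable d) (hu : ∀ i, Measurable (u i)) (n : ℕ) (ε δ p : ℝ) :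
    Measurable fun ω => fimaSol n ε δ p (z ω) (d ω) (fun i => u i ω) := by
  have ht : Measurable fun ω => p - z ω / (n * ε) := by fun_prop
  have hk : Measurable fun ω => ⌊(n : ℝ) * (p - z ω / (n * ε))⌋₊ :=
    Nat.measurable_floor.comp (ht.const_mul _)
  have hu' : Measurable fun ω i => u i ω := measurable_pi_lambda _ hu
  have haug : Measurable fun x : ℕ × (ℕ → ℝ) => augOrderStat n δ x.2 x.1 :=
    measurable_from_prod_countable_right fun k => measurable_augOrderStat n δ k
  have h₁ := haug.comp (hk.prodMk hu')
  have h₂ := haug.comp ((hk.add_const 1).prodMk hu')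
  unfold _root_.fimaSol
  exact Measurable.ite (measurableSet_le ht measurable_const) measurable_const <|
    Measurable.ite (measurableSet_le measurable_const ht) measurable_const <|
      h₁.add (hd.mul (h₂.sub h₁))

section FimaBounds

variable {n : ℕ} {ε δ p z d : ℝ} {u : ℕ → ℝ}

lemma fimaSol_mem_Icc (hd : d ∈ Set.Icc (0 : ℝ) 1) (ht : 1 ≤ n * (p - z / (n * ε)))
    (ht' : p - z / (n * ε) < 1) :
    1 ≤ ⌊(n : ℝ) * (p - z / (n * ε))⌋₊ ∧ ⌊(n : ℝ) * (p - z / (n * ε))⌋₊ + 1 ≤ n ∧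
      fimaSol n ε δ p z d u ∈ Set.Icc (kthSmallest n u ⌊(n : ℝ) * (p - z / (n * ε))⌋₊)
        (kthSmallest n u (⌊(n : ℝ) * (p - z / (n * ε))⌋₊ + 1)) := by
  have hn : (0 : ℝ) < n := by
    rcases (Nat.cast_nonneg n : (0 : ℝ) ≤ n).eq_or_lt with h | h
    · rw [← h] at ht; linarith
    · exact h
  unfold fimaSol
  set t := p - z / (n * ε)
  have ht0 : 0 < t := pos_of_mul_pos_right (by linarith) hn.le
  have hk : 1 ≤ ⌊(n : ℝ) * t⌋₊ := Nat.le_floor (by simpa using ht)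
  have hkn : ⌊(n : ℝ) * t⌋₊ < n := (Nat.floor_lt (by positivity)).2 (by nlinarith)
  have hle := kthSmallest_le_succ u hk hkn
  refine ⟨hk, hkn, ?_⟩
  simp only [augOrderStat, not_le.2 ht0, not_le.2 ht', if_false,
    if_neg (show ¬ ⌊(n : ℝ) * t⌋₊ = 0 by omega), if_neg (show ¬ n + 1 ≤ ⌊(n : ℝ) * t⌋₊ by omega),
    if_neg (show ¬ ⌊(n : ℝ) * t⌋₊ + 1 = 0 by omega),
    if_neg (show ¬ n + 1 ≤ ⌊(n : ℝ) * t⌋₊ + 1 by omega)]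
  constructor <;> nlinarith [hd.1, hd.2]

lemma natCast_mul_sub_div (hn : n ≠ 0) : (n : ℝ) * (p - z / (n * ε)) = n * p - z / ε := by
  have : (n : ℝ) ≠ 0 := Nat.cast_ne_zero.2 hn
  rw [mul_sub, ← mul_div_assoc, mul_div_mul_left _ _ this]

lemma le_card_of_fimaSol_le (hd : d ∈ Set.Icc (0 : ℝ) 1) (ht : 1 ≤ n * (p - z / (n * ε)))
    (ht' : p - z / (n * ε) < 1) {x : ℝ} (h : fimaSol n ε δ p z d u ≤ x) :
    n * p - 1 ≤ (((Finset.range n).filter fun i => u i ≤ x).card : ℝ) + z / ε := by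
  obtain ⟨hk, hkn, hS⟩ := fimaSol_mem_Icc (δ := δ) (u := u) hd ht ht'
  have hcard : (⌊(n : ℝ) * (p - z / (n * ε))⌋₊ : ℝ) ≤
      (((Finset.range n).filter fun i => u i ≤ x).card : ℝ) :=
    Nat.cast_le.2 <| (kthSmallest_le_iff u hk (by omega) x).1 (hS.1.trans h)
  have hfl := Nat.lt_floor_add_one ((n : ℝ) * (p - z / (n * ε)))
  rw [natCast_mul_sub_div (by omega)] at hcard hfl
  linarith

lemma fimaSol_lt_of_le_card (hd : d ∈ Set.Icc (0 : ℝ) 1) (ht : 1 ≤ n * (p - z / (n * ε)))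
    (ht' : p - z / (n * ε) < 1) {x : ℝ}
    (h : n * p + 1 ≤ (((Finset.range n).filter fun i => u i < x).card : ℝ) + z / ε) :
    fimaSol n ε δ p z d u < x := by
  obtain ⟨hk, hkn, hS⟩ := fimaSol_mem_Icc (δ := δ) (u := u) hd ht ht'
  refine hS.2.trans_lt (kthSmallest_lt_of_le_card u (by omega) ?_)
  have hfl := Nat.floor_le (zero_le_one.trans ht)
  rw [← Nat.cast_le (α := ℝ)]
  push_cast
  rw [natCast_mul_sub_div (by omega)] at hfl ⊢
  linarith

end FimaBounds

section ProbabilityOnReal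

variable (ν : Measure ℝ) [IsProbabilityMeasure ν]

/-- The `α`-quantile is at least `θ` as soon as the distribution function at `θ` is below `α`. -/
lemma le_sInf_quantile {α θ : ℝ} (hα : α < 1) (h : ν.real (Set.Iic θ) < α) :
    θ ≤ sInf {v : ℝ | ENNReal.ofReal α ≤ ν (Set.Iic v)} := by
  refine le_csInf ?_ fun v hv => ?_
  · have hlim := tendsto_measure_Iic_atTop ν
    rw [measure_univ] at hlim
    obtain ⟨v, hv⟩ := (hlim.eventually (lt_mem_nhds (ENNReal.ofReal_lt_one.2 hα))).exists
    exact ⟨v, hv.le⟩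
  · by_contra! hlt
    have h₁ : α ≤ ν.real (Set.Iic v) := (ENNReal.ofReal_le_iff_le_toReal (measure_ne_top _ _)).1 hv
    exact absurd (measureReal_mono (μ := ν) (Set.Iic_subset_Iic.2 hlt.le)) (by linarith)

lemma measureReal_Iio_le_of_le_sInf_quantile {α θ : ℝ} (hα : 0 < α)
    (h : θ ≤ sInf {v : ℝ | ENNReal.ofReal α ≤ ν (Set.Iic v)}) : ν.real (Set.Iio θ) ≤ α := by
  have hbdd : BddBelow {v : ℝ | ENNReal.ofReal α ≤ ν (Set.Iic v)} := by
    obtain ⟨m, hm⟩ := eventually_atBot.1 ((tendsto_cdf_atBot ν).eventually (gt_mem_nhds hα))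
    refine ⟨m, fun v hv => ?_⟩
    by_contra! hlt
    refine absurd (hm v hlt.le) (not_lt.2 ?_)
    rw [cdf_eq_real]
    exact (ENNReal.ofReal_le_iff_le_toReal (measure_ne_top _ _)).1 hv
  have hlt : ∀ v < θ, ν (Set.Iic v) ≤ ENNReal.ofReal α := fun v hv => by
    by_contra! hcon
    exact absurd (csInf_le hbdd hcon.le) (not_le.2 (hv.trans_le h))
  obtain ⟨v, hv, hvθ, hvlim⟩ := exists_seq_strictMono_tendsto θ
  have hU : Set.Iio θ = ⋃ m, Set.Iic (v m) := by
    ext y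
    simp only [Set.mem_Iio, Set.mem_iUnion, Set.mem_Iic]
    exact ⟨fun hy => ((hvlim.eventually (lt_mem_nhds hy)).exists).imp fun _ => le_of_lt,
      fun ⟨m, hm⟩ => hm.trans_lt (hvθ m)⟩
  refine ENNReal.toReal_le_of_le_ofReal hα.le ?_
  rw [hU, Monotone.measure_iUnion fun a b hab => Set.Iic_subset_Iic.2 (hv.monotone hab)]
  exact iSup_le fun m => hlt _ (hvθ m)

variable {ν} {η : ℝ}

lemma antitone_measureReal_Ici : Antitone fun x => ν.real (Set.Ici x) := fun _ _ h =>
  measureReal_mono (Set.Ici_subset_Ici.2 h)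

lemma measureReal_Ici_le_add (hη : ∀ x, ν.real (Set.Ico x (x + 1)) ≤ η) {x y : ℝ}
    (h : y ≤ x + 1) : ν.real (Set.Ici x) ≤ ν.real (Set.Ici y) + η := by
  have hsub : Set.Ici x ⊆ Set.Ici y ∪ Set.Ico x (x + 1) := fun w hw => by
    by_cases hwy : y ≤ w
    · exact Or.inl hwy
    · exact Or.inr ⟨hw, by linarith⟩
  exact (measureReal_mono hsub).trans <| (measureReal_union_le _ _).trans <|
    by linarith [hη x]

/-- The survival function evaluated at a variable with that law is nearly super-uniform. -/
lemma measureReal_survival_le_le (hη : ∀ x, ν.real (Set.Ico x (x + 1)) ≤ η) {a : ℝ}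
    (ha : 0 ≤ a) : ν.real {x | ν.real (Set.Ici x) ≤ a} ≤ a + η := by
  have hη0 : 0 ≤ η := measureReal_nonneg.trans (hη 0)
  set U := {x | ν.real (Set.Ici x) ≤ a}
  rcases U.eq_empty_or_nonempty with h | hne
  · rw [h, measureReal_empty]; linarith
  by_cases ha1 : 1 ≤ a
  · exact measureReal_le_one.trans (by linarith)
  have hbdd : BddBelow U := by
    have hlim : Tendsto (fun x => ν (Set.Ici x)) atBot (𝓝 (ν Set.univ)) :=
      tendsto_measure_Ici_atBot ν
    rw [measure_univ] at hlim
    have hlim' := (ENNReal.tendsto_toReal ENNReal.one_ne_top).comp hlim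
    obtain ⟨m, hm⟩ := eventually_atBot.1
      (hlim'.eventually (lt_mem_nhds (by simpa using not_le.1 ha1)))
    refine ⟨m, fun v hv => ?_⟩
    by_contra! hlt
    exact absurd (hm v hlt.le) (not_lt.2 hv)
  obtain ⟨x, hxU, hx⟩ := exists_lt_of_csInf_lt hne (lt_add_one (sInf U))
  calc ν.real U ≤ ν.real (Set.Ici (sInf U)) := measureReal_mono fun y hy => csInf_le hbdd hy
    _ ≤ ν.real (Set.Ici x) + η := measureReal_Ici_le_add hη hx.le
    _ ≤ a + η := by linarith [show ν.real (Set.Ici x) ≤ a from hxU]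

/-- The survival function evaluated at a variable with that law is nearly sub-uniform. -/
lemma le_measureReal_survival_lt (hη : ∀ x, ν.real (Set.Ico x (x + 1)) ≤ η) {a : ℝ}
    (ha : a ≤ 1) : a - 2 * η ≤ ν.real {x | ν.real (Set.Ici x) < a} := by
  have hη0 : 0 ≤ η := measureReal_nonneg.trans (hη 0)
  set U := {x | ν.real (Set.Ici x) < a}
  by_cases hUne : U = ∅
  · have hlim : Tendsto (fun x => ν (Set.Iio x)) atTop (𝓝 (ν Set.univ)) := by
      refine tendsto_of_tendsto_of_tendsto_of_le_of_le
        ((tendsto_measure_Iic_atTop ν).comp (tendsto_atTop_add_const_right _ (-1 : ℝ) tendsto_id))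
        tendsto_const_nhds (fun x => measure_mono fun y hy => ?_)
        (fun x => measure_mono (Set.subset_univ _))
      simp only [Set.mem_Iic, Set.mem_Iio, id] at hy ⊢
      linarith
    rw [measure_univ] at hlim
    have hlim' : Tendsto (fun x => ν.real (Set.Ici x)) atTop (𝓝 (1 - 1)) := by
      have := (tendsto_const_nhds (x := (1 : ℝ))).sub
        ((ENNReal.tendsto_toReal ENNReal.one_ne_top).comp hlim)
      refine this.congr fun x => ?_
      rw [← Set.compl_Iio, probReal_compl_eq_one_sub measurableSet_Iio]
      rfl
    have : a ≤ 1 - 1 := ge_of_tendsto hlim' (Eventually.of_forall fun x => by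
      by_contra! hx
      exact (Set.eq_empty_iff_forall_notMem.1 hUne x) hx)
    linarith [measureReal_nonneg (μ := ν) (s := U)]
  obtain ⟨b, hb⟩ := Set.nonempty_iff_ne_empty.2 hUne
  rcases Uᶜ.eq_empty_or_nonempty with h | hne
  · rw [Set.compl_empty_iff.1 h, probReal_univ]; linarith
  have hbdd : BddAbove Uᶜ := ⟨b, fun x hx => by
    by_contra! hlt
    exact hx (lt_of_le_of_lt (antitone_measureReal_Ici hlt.le) hb)⟩
  obtain ⟨x, hxU, hx⟩ := exists_lt_of_lt_csSup hne (sub_one_lt (sSup Uᶜ))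
  have hxa : a ≤ ν.real (Set.Ici x) := not_lt.1 hxU
  have h₁ := measureReal_Ici_le_add hη (show sSup Uᶜ ≤ x + 1 by linarith)
  have h₂ : Set.Ici (sSup Uᶜ) ⊆ U ∪ Set.Ico (sSup Uᶜ) (sSup Uᶜ + 1) := fun y hy => by
    by_cases hyU : y ∈ U
    · exact Or.inl hyU
    · exact Or.inr ⟨hy, by linarith [le_csSup hbdd hyU]⟩
  have h₃ := (measureReal_mono h₂).trans (measureReal_union_le (μ := ν) _ _)
  linarith [hη (sSup Uᶜ)]

/-- Anticoncentration: an interval of length two has small mass when the characteristic function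
is small on average with respect to a standard Gaussian. -/
lemma measureReal_Icc_le_integral_norm_charFun (x : ℝ) :
    ν.real (Set.Icc (x - 1) (x + 1)) ≤
      Real.exp (1 / 2) * ∫ s, ‖charFun ν s‖ ∂(gaussianReal 0 1) := by
  set γ := gaussianReal 0 1
  have hgauss : ∀ y : ℝ, ∫ s, Complex.exp (s * y * Complex.I) ∂γ = (Real.exp (-y ^ 2 / 2) : ℝ) := by
    intro y
    have := charFun_gaussianReal (μ := 0) (v := 1) y
    rw [charFun_apply_real] at this
    simp_rw [mul_comm (y : ℂ)] at this
    rw [this]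
    push_cast
    congr 1
    simp
    ring
  have hint : Integrable (Function.uncurry fun (w s : ℝ) =>
      Complex.exp (s * (w - x : ℝ) * Complex.I)) (ν.prod γ) := by
    refine Integrable.of_bound (C := 1) (by fun_prop) (ae_of_all _ fun q => ?_)
    simp only [Function.uncurry]
    rw [← Complex.ofReal_mul, Complex.norm_exp_ofReal_mul_I]
  have hswap := integral_integral_swap hint
  simp_rw [hgauss] at hswap
  have hinner : ∀ s : ℝ, ∫ w, Complex.exp (s * (w - x : ℝ) * Complex.I) ∂ν =
      Complex.exp (-(s * x : ℝ) * Complex.I) * charFun ν s := by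
    intro s
    rw [charFun_apply_real, ← integral_const_mul]
    congr 1 with w
    rw [← Complex.exp_add]
    congr 1
    push_cast
    ring
  simp_rw [hinner] at hswap
  rw [integral_complex_ofReal] at hswap
  have hbound : ∫ w, Real.exp (-(w - x) ^ 2 / 2) ∂ν ≤ ∫ s, ‖charFun ν s‖ ∂γ := by
    calc ∫ w, Real.exp (-(w - x) ^ 2 / 2) ∂ν
        ≤ ‖((∫ w, Real.exp (-(w - x) ^ 2 / 2) ∂ν : ℝ) : ℂ)‖ := by
          rw [Complex.norm_real]; exact le_abs_self _
      _ ≤ ∫ s, ‖Complex.exp (-(s * x : ℝ) * Complex.I) * charFun ν s‖ ∂γ := by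
          rw [hswap]; exact norm_integral_le_integral_norm _
      _ = ∫ s, ‖charFun ν s‖ ∂γ := by
          congr 1 with s
          rw [norm_mul, ← Complex.ofReal_neg, Complex.norm_exp_ofReal_mul_I, one_mul]
  have hexp : ν.real (Set.Icc (x - 1) (x + 1)) ≤
      ∫ w, Real.exp (1 / 2) * Real.exp (-(w - x) ^ 2 / 2) ∂ν := by
    rw [← integral_indicator_one measurableSet_Icc]
    refine integral_mono ((integrable_const (1 : ℝ)).indicator measurableSet_Icc) ?_ fun w => ?_
    · refine (Integrable.of_bound (C := 1) (by fun_prop) (ae_of_all _ fun w => ?_)).const_mul _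
      rw [Real.norm_eq_abs, Real.abs_exp, Real.exp_le_one_iff]
      nlinarith [sq_nonneg (w - x)]
    · refine Set.indicator_apply_le' (fun hw => ?_) (fun _ => by positivity)
      rw [← Real.exp_add, Pi.one_apply, Real.one_le_exp_iff]
      nlinarith [hw.1, hw.2]
  rw [integral_const_mul] at hexp
  exact hexp.trans (mul_le_mul_of_nonneg_left hbound (Real.exp_pos _).le)

end ProbabilityOnReal

section BernoulliSum

variable {Ω : Type*} [MeasurableSpace Ω] {μ : Measure Ω} [IsProbabilityMeasure μ] {θ : ℝ}

lemma charFun_map_of_zero_or_one (hθ : 0 ≤ θ) {X : Ω → ℝ} (hX : Measurable X)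
    (hX01 : ∀ ω, X ω = 0 ∨ X ω = 1) (hXθ : μ {ω | X ω = 1} = ENNReal.ofReal θ) (t : ℝ) :
    charFun (μ.map X) t = 1 - θ + θ * Complex.exp (t * Complex.I) := by
  have hmeas : MeasurableSet {ω | X ω = 1} := hX (measurableSet_singleton 1)
  rw [charFun_apply_real, integral_map hX.aemeasurable (by fun_prop)]
  have heq : ∀ ω, Complex.exp (t * X ω * Complex.I) =
      1 + {ω | X ω = 1}.indicator (fun _ => Complex.exp (t * Complex.I) - 1) ω := by
    intro ω
    rcases hX01 ω with h | h <;> simp [h]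
  simp_rw [heq]
  rw [integral_add (integrable_const _) ((integrable_const _).indicator hmeas),
    integral_indicator_const _ hmeas, measureReal_def, hXθ, ENNReal.toReal_ofReal hθ]
  simp
  ring

lemma norm_bernoulli_charFun_lt_one (hθ : θ ∈ Set.Ioo (0 : ℝ) 1) {t : ℝ}
    (ht : Complex.exp (t * Complex.I) ≠ 1) :
    ‖(1 - θ + θ * Complex.exp (t * Complex.I) : ℂ)‖ < 1 := by
  have hnorm : ‖(1 - θ + θ * Complex.exp (t * Complex.I) : ℂ)‖ ^ 2 =
      1 - 2 * θ * (1 - θ) * (1 - Real.cos t) := by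
    rw [Complex.sq_norm, Complex.normSq_apply]
    simp [Complex.exp_ofReal_mul_I_re, Complex.exp_ofReal_mul_I_im]
    linear_combination θ ^ 2 * Real.sin_sq_add_cos_sq t
  have hcos : Real.cos t < 1 := by
    refine lt_of_le_of_ne (Real.cos_le_one t) fun h => ht ?_
    have hs : Real.sin t = 0 := by nlinarith [Real.sin_sq_add_cos_sq t]
    rw [Complex.exp_mul_I, ← Complex.ofReal_cos, ← Complex.ofReal_sin, h, hs]
    simp
  have hpos : 0 < θ * (1 - θ) * (1 - Real.cos t) :=
    mul_pos (mul_pos hθ.1 (by linarith [hθ.2])) (by linarith)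
  nlinarith [norm_nonneg (1 - θ + θ * Complex.exp (t * Complex.I) : ℂ)]

lemma norm_bernoulli_charFun_le_one (hθ : θ ∈ Set.Ioo (0 : ℝ) 1) (t : ℝ) :
    ‖(1 - θ + θ * Complex.exp (t * Complex.I) : ℂ)‖ ≤ 1 := by
  by_cases ht : Complex.exp (t * Complex.I) = 1
  · simp [ht]
  · exact (norm_bernoulli_charFun_lt_one hθ ht).le

lemma tendsto_integral_norm_bernoulli_charFun_pow (hθ : θ ∈ Set.Ioo (0 : ℝ) 1) :
    Tendsto (fun n : ℕ => ∫ t : ℝ, ‖(1 - θ + θ * Complex.exp (t * Complex.I) : ℂ)‖ ^ n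
      ∂(gaussianReal 0 1)) atTop (𝓝 0) := by
  have hnull : ∀ᵐ t : ℝ ∂(gaussianReal 0 1), Complex.exp (t * Complex.I) ≠ 1 := by
    have := nullSingletonClass_gaussianReal (μ := 0) (v := 1) one_ne_zero
    refine measure_mono_null (fun t ht => ?_)
      ((Set.countable_range fun m : ℤ => (m : ℝ) * (2 * Real.pi)).measure_zero (gaussianReal 0 1))
    obtain ⟨m, hm⟩ := Complex.exp_eq_one_iff.1 (not_not.1 ht)
    refine ⟨m, ?_⟩
    have : (t : ℂ) = m * (2 * Real.pi) := by
      refine mul_right_cancel₀ Complex.I_ne_zero (hm.trans (by ring))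
    exact_mod_cast this.symm
  suffices h : Tendsto (fun n : ℕ => ∫ t : ℝ, ‖(1 - θ + θ * Complex.exp (t * Complex.I) : ℂ)‖ ^ n
      ∂(gaussianReal 0 1)) atTop (𝓝 (∫ _, (0 : ℝ) ∂(gaussianReal 0 1))) by
    rwa [integral_zero] at h
  refine tendsto_integral_of_dominated_convergence (fun _ => 1)
    (fun n => Continuous.aestronglyMeasurable (by fun_prop))
    (integrable_const 1) (fun n => ae_of_all _ fun t => ?_) ?_
  · rw [norm_pow, norm_norm]
    exact pow_le_one₀ (norm_nonneg _) (norm_bernoulli_charFun_le_one hθ t)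
  · filter_upwards [hnull] with t ht
    exact tendsto_pow_atTop_nhds_zero_of_lt_one (norm_nonneg _)
      (norm_bernoulli_charFun_lt_one hθ ht)

/-- The characteristic function of a binomial count plus scaled independent Gaussian noise. -/
lemma charFun_map_sum_add_gaussian (hθ : 0 ≤ θ) (ε : ℝ) {X : ℕ → Ω → ℝ}
    (hX : ∀ i, Measurable (X i)) (hX01 : ∀ i ω, X i ω = 0 ∨ X i ω = 1)
    (hXθ : ∀ i, μ {ω | X i ω = 1} = ENNReal.ofReal θ) (hXindep : iIndepFun X μ)
    {Z : Ω → ℝ} (hZ : Measurable Z) (hZdist : μ.map Z = gaussianReal 0 1) (n : ℕ)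
    (hXZ : IndepFun (fun ω => ∑ i ∈ Finset.range n, X i ω) Z μ) (t : ℝ) :
    charFun (μ.map fun ω => ∑ i ∈ Finset.range n, X i ω + Z ω / ε) t =
      (1 - θ + θ * Complex.exp (t * Complex.I)) ^ n *
        charFun ((gaussianReal 0 1).map (· / ε)) t := by
  have hindep : IndepFun (fun ω => ∑ i ∈ Finset.range n, X i ω) (fun ω => Z ω / ε) μ :=
    hXZ.comp measurable_id (measurable_id.div_const ε)
  rw [hindep.charFun_map_fun_add_eq_mul (by fun_prop) (by fun_prop), Pi.mul_apply,
    iIndepFun.charFun_map_fun_finsetSum_eq_prod (fun i _ => (hX i).aemeasurable)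
      (hXindep.restrict _), Finset.prod_apply,
    Finset.prod_congr rfl fun i _ => charFun_map_of_zero_or_one hθ (hX i) (hX01 i) (hXθ i) t,
    Finset.prod_const, Finset.card_range, ← hZdist, Measure.map_map (by fun_prop) hZ]
  rfl

end BernoulliSum

/-- A count of uniform variables in `J` plus scaled Gaussian noise has the same characteristic
function as a binomial count plus the same noise. -/
lemma charFun_map_card_add_gaussian {Ω : Type*} [MeasurableSpace Ω] {μ : Measure Ω}
    [IsProbabilityMeasure μ] {θ : ℝ} (hθ : 0 ≤ θ) (ε : ℝ) {V : ℕ → Ω → ℝ}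
    (hV : ∀ j, Measurable (V j)) (hVindep : iIndepFun V μ)
    (hZ : μ.map (V 0) = gaussianReal 0 1)
    (hU : ∀ i : ℕ, μ.map (V (i + 2)) = volume.restrict (Set.Icc (0 : ℝ) 1))
    {J : ℝ → Prop} [DecidablePred J] (hJ : MeasurableSet {x | J x})
    (hJθ : volume ({x | J x} ∩ Set.Icc (0 : ℝ) 1) = ENNReal.ofReal θ) (n : ℕ) (t : ℝ) :
    charFun (μ.map fun ω =>
        (((Finset.range n).filter fun i => J (V (i + 2) ω)).card : ℝ) + V 0 ω / ε) t =
      (1 - θ + θ * Complex.exp (t * Complex.I)) ^ n *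
        charFun ((gaussianReal 0 1).map (· / ε)) t := by
  have hg : Measurable fun x : ℝ => if J x then (1 : ℝ) else 0 :=
    Measurable.ite hJ measurable_const measurable_const
  have hinj : Function.Injective fun i : ℕ => i + 2 := fun a b h => by simpa using h
  have hindep := (hVindep.precomp hinj).comp (fun _ x => if J x then (1 : ℝ) else 0) fun _ => hg
  have hsum : IndepFun (fun ω => ∑ i ∈ Finset.range n, if J (V (i + 2) ω) then (1 : ℝ) else 0)
      (V 0) μ := by
    set T := (Finset.range n).image (· + 2)
    have hT : Disjoint T {0} := by simp [T]
    have h := hVindep.indepFun_finset T {0} hT hV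
    have hmem : ∀ i ∈ Finset.range n, i + 2 ∈ T := fun i hi => Finset.mem_image_of_mem _ hi
    have hφ : Measurable fun v : T → ℝ => ∑ i ∈ (Finset.range n).attach,
        if J (v ⟨i + 2, hmem i i.2⟩) then (1 : ℝ) else 0 :=
      Finset.measurable_fun_sum _ fun i _ => hg.comp (measurable_pi_apply _)
    have hψ : Measurable fun v : ({0} : Finset ℕ) → ℝ => v ⟨0, Finset.mem_singleton_self 0⟩ :=
      measurable_pi_apply _
    convert h.comp hφ hψ using 1
    · ext ω
      exact (Finset.sum_attach (Finset.range n)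
        fun i => if J (V (i + 2) ω) then (1 : ℝ) else 0).symm
    · rfl
  simp_rw [← Finset.sum_boole]
  refine charFun_map_sum_add_gaussian hθ ε (fun i => hg.comp (hV (i + 2)))
    (fun i ω => ?_) (fun i => ?_) hindep (hV 0) hZ n hsum t
  · by_cases h : J (V (i + 2) ω) <;> simp [h]
  · rw [← hJθ, ← Measure.restrict_apply hJ, ← hU i, Measure.map_apply (hV _) hJ]
    congr 1
    ext ω
    by_cases h : J (V (i + 2) ω) <;> simp [h]

/-- Up to the probability that the fresh noise is large, the distribution function of the FIMA
solution at `θ` is the survival function, at `n p` shifted by at most one, of the law of a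
binomial count plus scaled Gaussian noise. -/
lemma fimaSol_cdf_bounds {Ω : Type*} [MeasurableSpace Ω] {μ : Measure Ω}
    [IsProbabilityMeasure μ] {θ : ℝ} (hθ : θ ∈ Set.Ioo (0 : ℝ) 1) (ε δ : ℝ) {V : ℕ → Ω → ℝ}
    (hV : ∀ j, Measurable (V j)) (hVindep : iIndepFun V μ)
    (hZ : μ.map (V 0) = gaussianReal 0 1)
    (hD : μ.map (V 1) = volume.withDensity (betaDensity (1/2) (1/2)))
    (hU : ∀ i : ℕ, μ.map (V (i + 2)) = volume.restrict (Set.Icc (0 : ℝ) 1))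
    {n : ℕ} {ν : Measure ℝ} [IsProbabilityMeasure ν]
    (hν : ∀ t : ℝ, charFun ν t = (1 - θ + θ * Complex.exp (t * Complex.I)) ^ n *
        charFun ((gaussianReal 0 1).map (· / ε)) t)
    {p c : ℝ} (hcθ : 3 * c ≤ θ) (hcθ' : 3 * c ≤ 1 - θ) (hnc : 1 ≤ n * c) (hp : |p - θ| < c) :
    μ.real {ω | fimaSol n ε δ p (V 0 ω) (V 1 ω) (fun i => V (i + 2) ω) ≤ θ} ≤
        ν.real (Set.Ici (n * p - 1)) + μ.real {ω | c ≤ ‖V 0 ω / (n * ε) - 0‖} ∧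
      ν.real (Set.Ici (n * p + 1)) ≤
        μ.real {ω | fimaSol n ε δ p (V 0 ω) (V 1 ω) (fun i => V (i + 2) ω) < θ} +
          μ.real {ω | c ≤ ‖V 0 ω / (n * ε) - 0‖} := by
  have hlaw : ∀ {J : ℝ → Prop} [DecidablePred J], MeasurableSet {x | J x} →
      volume ({x | J x} ∩ Set.Icc (0 : ℝ) 1) = ENNReal.ofReal θ → ∀ x : ℝ,
      ν.real (Set.Ici x) = μ.real {ω | x ≤
        (((Finset.range n).filter fun i => J (V (i + 2) ω)).card : ℝ) + V 0 ω / ε} := by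
    intro J _ hJ hJθ x
    have hmeas : Measurable fun ω =>
        (((Finset.range n).filter fun i => J (V (i + 2) ω)).card : ℝ) + V 0 ω / ε := by
      simp_rw [← Finset.sum_boole]
      refine Measurable.add (Finset.measurable_fun_sum _ fun i _ => ?_) ((hV 0).div_const ε)
      exact Measurable.ite (hV _ hJ) measurable_const measurable_const
    have := Measure.isProbabilityMeasure_map (μ := μ) hmeas.aemeasurable
    have heq : ν = μ.map fun ω =>
        (((Finset.range n).filter fun i => J (V (i + 2) ω)).card : ℝ) + V 0 ω / ε :=
      Measure.ext_of_charFun <| funext fun t => by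
        rw [hν, charFun_map_card_add_gaussian hθ.1.le ε hV hVindep hZ hU hJ hJθ]
    rw [heq, map_measureReal_apply hmeas measurableSet_Ici]
    rfl
  have hle := hlaw (J := (· ≤ θ)) measurableSet_Iic (by
    rw [show {x | x ≤ θ} ∩ Set.Icc (0 : ℝ) 1 = Set.Icc 0 θ by
      ext x
      simp only [Set.mem_inter_iff, Set.mem_ofPred_eq, Set.mem_Icc]
      exact ⟨fun h => ⟨h.2.1, h.1⟩, fun h => ⟨h.2, h.1, h.2.trans hθ.2.le⟩⟩]
    simp)
  have hlt := hlaw (J := (· < θ)) measurableSet_Iio (by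
    rw [show {x | x < θ} ∩ Set.Icc (0 : ℝ) 1 = Set.Ico 0 θ by
      ext x
      simp only [Set.mem_inter_iff, Set.mem_ofPred_eq, Set.mem_Icc, Set.mem_Ico]
      exact ⟨fun h => ⟨h.2.1, h.1⟩, fun h => ⟨h.2, h.1, h.2.le.trans hθ.2.le⟩⟩]
    simp)
  have hD01 : μ.real {ω | V 1 ω ∉ Set.Icc (0 : ℝ) 1} = 0 := by
    have h : μ.map (V 1) (Set.Icc 0 1)ᶜ = 0 := by
      rw [hD, withDensity_apply _ measurableSet_Icc.compl,
        setLIntegral_congr_fun measurableSet_Icc.compl (g := fun _ => 0), lintegral_zero]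
      intro x hx
      have hx' : x ∉ Set.Ioo (0 : ℝ) 1 := fun h => hx (Set.Ioo_subset_Icc_self h)
      simp only [betaDensity, Set.indicator_of_notMem hx', ENNReal.ofReal_zero]
    rw [Measure.map_apply (hV 1) measurableSet_Icc.compl] at h
    exact (congrArg ENNReal.toReal h).trans ENNReal.toReal_zero
  have hgood : ∀ ω, ω ∉ {ω | c ≤ ‖V 0 ω / (n * ε) - 0‖} →
      1 ≤ n * (p - V 0 ω / (n * ε)) ∧ p - V 0 ω / (n * ε) < 1 := by
    intro ω hω
    rw [Set.mem_ofPred_eq, not_le, sub_zero, Real.norm_eq_abs, abs_lt] at hω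
    rw [abs_lt] at hp
    exact ⟨hnc.trans (mul_le_mul_of_nonneg_left (by linarith) (Nat.cast_nonneg n)), by linarith⟩
  constructor
  · rw [hle]
    refine (measureReal_mono (s₂ := ({ω | n * p - 1 ≤
        (((Finset.range n).filter fun i => V (i + 2) ω ≤ θ).card : ℝ) + V 0 ω / ε} ∪
      {ω | c ≤ ‖V 0 ω / (n * ε) - 0‖}) ∪ {ω | V 1 ω ∉ Set.Icc (0 : ℝ) 1}) fun ω hω => ?_).trans
      ((measureReal_union_le _ _).trans ?_)
    · by_contra hcon
      simp only [Set.mem_union, not_or] at hcon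
      obtain ⟨h₁, h₂⟩ := hgood ω hcon.1.2
      exact hcon.1.1 (le_card_of_fimaSol_le (not_not.1 hcon.2) h₁ h₂ hω)
    · rw [hD01, add_zero]
      exact measureReal_union_le _ _
  · rw [hlt]
    refine (measureReal_mono (s₂ := ({ω | fimaSol n ε δ p (V 0 ω) (V 1 ω)
        (fun i => V (i + 2) ω) < θ} ∪ {ω | c ≤ ‖V 0 ω / (n * ε) - 0‖}) ∪
      {ω | V 1 ω ∉ Set.Icc (0 : ℝ) 1}) fun ω hω => ?_).trans
      ((measureReal_union_le _ _).trans ?_)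
    · by_contra hcon
      simp only [Set.mem_union, not_or] at hcon
      obtain ⟨h₁, h₂⟩ := hgood ω hcon.1.2
      exact hcon.1.1 (fimaSol_lt_of_le_card (not_not.1 hcon.2) h₁ h₂ hω)
    · rw [hD01, add_zero]
      exact measureReal_union_le _ _

lemma tendsto_div_natCast_mul (a ε : ℝ) :
    Tendsto (fun n : ℕ => a / (n * ε)) atTop (𝓝 0) := by
  have := tendsto_const_div_atTop_nhds_zero_nat (a / ε)
  refine this.congr fun n => ?_
  rw [div_div, mul_comm]

/-- A sample proportion released with vanishing additive noise is consistent. -/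
lemma ae_tendsto_noisy_proportion {Ω : Type*} [MeasurableSpace Ω] {μ : Measure Ω}
    [IsProbabilityMeasure μ] {θ : ℝ} (hθ : 0 ≤ θ) (ε : ℝ) {X : ℕ → Ω → ℝ}
    (hX : ∀ i, Measurable (X i)) (hX01 : ∀ i ω, X i ω = 0 ∨ X i ω = 1)
    (hXθ : ∀ i, μ {ω | X i ω = 1} = ENNReal.ofReal θ) (hXindep : iIndepFun X μ) (Z : Ω → ℝ) :
    ∀ᵐ ω ∂μ, Tendsto (fun n : ℕ => (∑ i ∈ Finset.range n, X i ω) / n + Z ω / (n * ε)) atTop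
      (𝓝 θ) := by
  have hint : Integrable (X 0) μ :=
    Integrable.of_bound (hX 0).aestronglyMeasurable 1 (ae_of_all _ fun ω => by
      rcases hX01 0 ω with h | h <;> simp [h])
  have hident : ∀ i, IdentDistrib (X i) (X 0) μ μ := fun i =>
    { aemeasurable_fst := (hX i).aemeasurable
      aemeasurable_snd := (hX 0).aemeasurable
      map_eq := by
        have := Measure.isProbabilityMeasure_map (μ := μ) (hX i).aemeasurable
        have := Measure.isProbabilityMeasure_map (μ := μ) (hX 0).aemeasurable
        refine Measure.ext_of_charFun (funext fun t => ?_)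
        rw [charFun_map_of_zero_or_one hθ (hX i) (hX01 i) (hXθ i),
          charFun_map_of_zero_or_one hθ (hX 0) (hX01 0) (hXθ 0)] }
  have hmean : ∫ ω, X 0 ω ∂μ = θ := by
    have heq : ∀ ω, X 0 ω = {ω | X 0 ω = 1}.indicator (fun _ => (1 : ℝ)) ω := fun ω => by
      rcases hX01 0 ω with h | h <;> simp [h]
    have hmeas : MeasurableSet {ω | X 0 ω = 1} := hX 0 (measurableSet_singleton 1)
    rw [integral_congr_ae (ae_of_all _ heq), integral_indicator_const _ hmeas, measureReal_def, hXθ,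
      ENNReal.toReal_ofReal hθ, smul_eq_mul, mul_one]
  filter_upwards [strong_law_ae_real X hint (fun i j hij => hXindep.indepFun hij) hident] with ω hω
  rw [hmean] at hω
  simpa using hω.add (tendsto_div_natCast_mul (Z ω) ε)

/-- Theorem 1 (Gaussian-mechanism instantiation): asymptotic validity of the FIMA
one-sided confidence bound. The data are i.i.d. Bernoulli(`θ₀`) with `θ₀ ∈ (0,1)`,
the released statistic is `π̂ₙ = θ̄ₙ + Z/(nε)` with independent standard Gaussian `Z`,
and the FIMA solution is built on an auxiliary space from independent randomness
`V 0 ~ N(0,1)` (fresh noise `Z⋆`), `V 1 ~ Beta(1/2,1/2)` (interpolation `D`) and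
`V (i+2) ~ Uniform(0,1)` (the fresh uniform sample `Uᵢ⋆`). Then the coverage of the
`α`-quantile `q_α⁽ⁿ⁾(π̂ₙ)` of the FIMA distribution converges to `α`:
`ℙ(θ₀ ≤ q_α⁽ⁿ⁾(π̂ₙ)) → α`. -/
theorem fima_binomial_coverage
    {Ω : Type*} [MeasurableSpace Ω] (μ : Measure Ω) [IsProbabilityMeasure μ]
    {Ω' : Type*} [MeasurableSpace Ω'] (μ' : Measure Ω') [IsProbabilityMeasure μ']
    (θ₀ : ℝ) (hθ₀ : θ₀ ∈ Set.Ioo (0 : ℝ) 1) (ε : ℝ) (hε : 0 < ε)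
    (α : ℝ) (hα : α ∈ Set.Ioo (0 : ℝ) 1) (δ : ℝ) (hδ : δ ∈ Set.Ioo (0 : ℝ) (1/2))
    -- the data and the released DP proportion
    (X : ℕ → Ω → ℝ) (hXmeas : ∀ i, Measurable (X i))
    (hX01 : ∀ (i : ℕ) (ω : Ω), X i ω = 0 ∨ X i ω = 1)
    (hXθ : ∀ i, μ {ω | X i ω = 1} = ENNReal.ofReal θ₀)
    (hXindep : iIndepFun X μ)
    (Z : Ω → ℝ) (hZmeas : Measurable Z)
    (hZdist : Measure.map Z μ = gaussianReal 0 1)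
    (hZindep : IndepFun (fun ω => fun i : ℕ => X i ω) Z μ)
    (piHat : ℕ → Ω → ℝ)
    (hpiHat : ∀ (n : ℕ) (ω : Ω),
      piHat n ω = (∑ i ∈ Finset.range n, X i ω) / n + Z ω / (n * ε))
    -- the auxiliary randomness: V 0 = Z⋆, V 1 = D, V (i+2) = Uᵢ⋆, mutually independent
    (V : ℕ → Ω' → ℝ) (hVmeas : ∀ j, Measurable (V j))
    (hVindep : iIndepFun V μ')
    (hZstar : Measure.map (V 0) μ' = gaussianReal 0 1)
    (hD : Measure.map (V 1) μ' = volume.withDensity (betaDensity (1/2) (1/2)))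
    (hU : ∀ i : ℕ, Measure.map (V (i + 2)) μ' = volume.restrict (Set.Icc (0 : ℝ) 1))
    -- the FIMA solution, its conditional law given the released value, and its α-quantile
    (S : ℕ → ℝ → Ω' → ℝ)
    (hS : ∀ (n : ℕ) (p : ℝ) (ω' : Ω'),
      S n p ω' = fimaSol n ε δ p (V 0 ω') (V 1 ω') (fun i => V (i + 2) ω'))
    (q : ℕ → ℝ → ℝ)
    (hq : ∀ (n : ℕ) (p : ℝ),
      q n p = sInf {v : ℝ | ENNReal.ofReal α ≤ Measure.map (S n p) μ' (Set.Iic v)}) :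
    Tendsto (fun n : ℕ => (μ {ω | θ₀ ≤ q n (piHat n ω)}).toReal) atTop (𝓝 α) := by
  set η : ℕ → ℝ := fun n => Real.exp (1 / 2) *
    ∫ t : ℝ, ‖(1 - θ₀ + θ₀ * Complex.exp (t * Complex.I) : ℂ)‖ ^ n ∂(gaussianReal 0 1)
  have hηlim : Tendsto η atTop (𝓝 0) := by
    have h := (tendsto_integral_norm_bernoulli_charFun_pow hθ₀).const_mul (Real.exp (1 / 2))
    rwa [mul_zero] at h
  obtain ⟨c, hc, hcθ, hcθ'⟩ : ∃ c : ℝ, 0 < c ∧ 3 * c ≤ θ₀ ∧ 3 * c ≤ 1 - θ₀ := by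
    refine ⟨min θ₀ (1 - θ₀) / 3, ?_, ?_, ?_⟩
    · have := lt_min hθ₀.1 (sub_pos.2 hθ₀.2)
      linarith
    · linarith [min_le_left θ₀ (1 - θ₀)]
    · linarith [min_le_right θ₀ (1 - θ₀)]
  set b : ℕ → ℝ := fun n => μ.real {ω | c ≤ ‖piHat n ω - θ₀‖}
  set b' : ℕ → ℝ := fun n => μ'.real {ω | c ≤ ‖V 0 ω / (n * ε) - 0‖}
  have hpimeas : ∀ n, Measurable (piHat n) := fun n => by
    rw [show piHat n = _ from funext (hpiHat n)]
    fun_prop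
  have hblim : Tendsto b atTop (𝓝 0) := by
    refine tendstoInMeasure_iff_measureReal_norm.1 (tendstoInMeasure_of_tendsto_ae
      (g := fun _ => θ₀) (fun n => (hpimeas n).aestronglyMeasurable) ?_) c hc
    simp_rw [hpiHat]
    exact ae_tendsto_noisy_proportion hθ₀.1.le ε hXmeas hX01 hXθ hXindep Z
  have hb'lim : Tendsto b' atTop (𝓝 0) :=
    tendstoInMeasure_iff_measureReal_norm.1 (tendstoInMeasure_of_tendsto_ae (g := fun _ => 0)
      (fun n => ((hVmeas 0).div_const _).aestronglyMeasurable)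
      (ae_of_all _ fun ω => tendsto_div_natCast_mul (V 0 ω) ε)) c hc
  have hlower : Tendsto (fun n => (α - η n - b' n) - 2 * η n - b n) atTop (𝓝 α) := by
    simpa using (((tendsto_const_nhds (x := α)).sub hηlim).sub hb'lim).sub
      (hηlim.const_mul 2) |>.sub hblim
  have hupper : Tendsto (fun n => (α + η n + b' n) + η n + b n) atTop (𝓝 α) := by
    simpa using (((tendsto_const_nhds (x := α)).add hηlim).add hb'lim).add hηlim |>.add hblim
  have hlarge : ∀ᶠ n : ℕ in atTop, 1 ≤ n * c :=
    (tendsto_natCast_atTop_atTop.atTop_mul_const hc).eventually_ge_atTop 1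
  have key : ∀ n : ℕ, 1 ≤ n * c →
      (α - η n - b' n) - 2 * η n - b n ≤ μ.real {ω | θ₀ ≤ q n (piHat n ω)} ∧
        μ.real {ω | θ₀ ≤ q n (piHat n ω)} ≤ (α + η n + b' n) + η n + b n := by
    intro n hn
    have hn0 : (n : ℝ) ≠ 0 := by
      rintro h
      rw [h] at hn
      linarith
    set W : Ω → ℝ := fun ω => ∑ i ∈ Finset.range n, X i ω + Z ω / ε with hW
    have hWmeas : Measurable W := by fun_prop
    have hpiW : ∀ ω, n * piHat n ω = W ω := fun ω => by
      rw [hpiHat, hW]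
      field_simp
    set ν := μ.map W
    have : IsProbabilityMeasure ν := Measure.isProbabilityMeasure_map hWmeas.aemeasurable
    have hν : ∀ t : ℝ, charFun ν t = (1 - θ₀ + θ₀ * Complex.exp (t * Complex.I)) ^ n *
        charFun ((gaussianReal 0 1).map (· / ε)) t := by
      refine charFun_map_sum_add_gaussian hθ₀.1.le ε hXmeas hX01 hXθ hXindep hZmeas hZdist n ?_
      exact hZindep.comp (φ := fun x : ℕ → ℝ => ∑ i ∈ Finset.range n, x i) (by fun_prop)
        measurable_id
    have hIco : ∀ x, ν.real (Set.Ico x (x + 1)) ≤ η n := fun x => by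
      have hsub : Set.Ico x (x + 1) ⊆ Set.Icc (x - 1) (x + 1) :=
        fun y hy => ⟨by linarith [hy.1], hy.2.le⟩
      refine (measureReal_mono hsub).trans
        ((measureReal_Icc_le_integral_norm_charFun x).trans ?_)
      refine mul_le_mul_of_nonneg_left (integral_mono ?_ ?_ fun t => ?_) (Real.exp_pos _).le
      · exact Integrable.of_bound (C := 1) measurable_charFun.norm.aestronglyMeasurable
          (ae_of_all _ fun t => by simpa using norm_charFun_le_one t)
      · refine Integrable.of_bound (C := 1) (Continuous.aestronglyMeasurable (by fun_prop))
          (ae_of_all _ fun t => ?_)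
        rw [norm_pow, norm_norm]
        exact pow_le_one₀ (norm_nonneg _) (norm_bernoulli_charFun_le_one hθ₀ t)
      · have := Measure.isProbabilityMeasure_map (μ := gaussianReal 0 1) (f := (· / ε))
          (by fun_prop)
        rw [hν, norm_mul, norm_pow]
        exact mul_le_of_le_one_right (by positivity) (norm_charFun_le_one t)
    have hSmeas : ∀ p, Measurable (S n p) := fun p => by
      rw [show S n p = _ from funext (hS n p)]
      exact (hVmeas 0).fimaSol (hVmeas 1) (fun i => hVmeas (i + 2)) n ε δ p
    have hSprob : ∀ p, IsProbabilityMeasure (μ'.map (S n p)) := fun p =>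
      Measure.isProbabilityMeasure_map (hSmeas p).aemeasurable
    have hcdf : ∀ p, |p - θ₀| < c →
        (μ'.map (S n p)).real (Set.Iic θ₀) ≤ ν.real (Set.Ici (n * p)) + η n + b' n ∧
          ν.real (Set.Ici (n * p)) ≤ (μ'.map (S n p)).real (Set.Iio θ₀) + b' n + η n := by
      intro p hp
      obtain ⟨h₁, h₂⟩ := fimaSol_cdf_bounds hθ₀ ε δ hVmeas hVindep hZstar hD hU hν hcθ hcθ' hn hp
      simp_rw [← hS] at h₁ h₂
      rw [map_measureReal_apply (hSmeas p) measurableSet_Iic,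
        map_measureReal_apply (hSmeas p) measurableSet_Iio]
      have h₃ := measureReal_Ici_le_add hIco (show n * p ≤ n * p - 1 + 1 by linarith)
      have h₄ := measureReal_Ici_le_add hIco (le_refl (n * p + 1))
      exact ⟨h₁.trans (by linarith), h₄.trans (add_le_add_left h₂ _)⟩
    have hpull : ∀ {A : Set ℝ}, MeasurableSet A → ν.real A = μ.real {ω | W ω ∈ A} :=
      fun hA => map_measureReal_apply hWmeas hA
    have hGmeas : Measurable fun x => ν.real (Set.Ici x) := antitone_measureReal_Ici.measurable
    have hη0 : 0 ≤ η n := measureReal_nonneg.trans (hIco 0)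
    have hb'0 : 0 ≤ b' n := measureReal_nonneg
    constructor
    · have h := le_measureReal_survival_lt hIco
        (show α - η n - b' n ≤ 1 by linarith [hα.2])
      rw [hpull (measurableSet_lt hGmeas measurable_const)] at h
      have hsub : {ω | W ω ∈ {x | ν.real (Set.Ici x) < α - η n - b' n}} ⊆
          {ω | θ₀ ≤ q n (piHat n ω)} ∪ {ω | c ≤ ‖piHat n ω - θ₀‖} := fun ω hω => by
        by_cases hgood : c ≤ ‖piHat n ω - θ₀‖
        · exact Or.inr hgood
        left
        have hω' : ν.real (Set.Ici (W ω)) < α - η n - b' n := hω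
        have := (hcdf _ (not_le.1 hgood)).1
        rw [hpiW] at this
        rw [Set.mem_ofPred_eq, hq]
        exact le_sInf_quantile _ hα.2 (by linarith)
      linarith [(measureReal_mono (μ := μ) hsub).trans (measureReal_union_le _ _)]
    · have h := measureReal_survival_le_le hIco
        (show 0 ≤ α + η n + b' n by linarith [hα.1])
      rw [hpull (measurableSet_le hGmeas measurable_const)] at h
      have hsub : {ω | θ₀ ≤ q n (piHat n ω)} ⊆
          {ω | W ω ∈ {x | ν.real (Set.Ici x) ≤ α + η n + b' n}} ∪
            {ω | c ≤ ‖piHat n ω - θ₀‖} := fun ω hω => by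
        by_cases hgood : c ≤ ‖piHat n ω - θ₀‖
        · exact Or.inr hgood
        left
        have h₁ := (hcdf _ (not_le.1 hgood)).2
        rw [hpiW] at h₁
        rw [Set.mem_ofPred_eq, hq] at hω
        have h₂ := measureReal_Iio_le_of_le_sInf_quantile _ hα.1 hω
        change ν.real (Set.Ici (W ω)) ≤ α + η n + b' n
        linarith
      linarith [(measureReal_mono (μ := μ) hsub).trans (measureReal_union_le _ _)]
  exact tendsto_of_tendsto_of_tendsto_of_le_of_le' hlower hupper
    (hlarge.mono fun n hn => (key n hn).1) (hlarge.mono fun n hn => (key n hn).2)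
end
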